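/- (Local a posteriori state-space error bound, conservative Galerkin.) Under the stated hypotheses, with ζ_G := ‖Σ_G⁻¹ U_Gᵀ C̄‖, the state-space error satisfies ‖e^n‖ ≤ (1 + ζ_G) Σ_{ℓ=0}^k ε_ℓ ‖(I_N − P_G) f(x_0 + Φ x̂^{n−ℓ}, t^{n−ℓ})‖ + Σ_{ℓ=1}^k γ_ℓ ‖e^{n−ℓ}‖. -/

import Mathlib

open Matrix Finset

noncomputable def euclNorm {n : ℕ} (v : Fin n → ℝ) : ℝ := Real.sqrt (∑ i, v i ^ 2)

noncomputable def matNorm {m n : ℕ} (M : Matrix (Fin m) (Fin n) ℝ) : ℝ :=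
  ‖LinearMap.toContinuousLinearMap (Matrix.toEuclideanLin M)‖

theorem euclNorm_eq_norm {n : ℕ} (v : Fin n → ℝ) : euclNorm v = ‖WithLp.toLp 2 v‖ := by
  simp [euclNorm, EuclideanSpace.norm_eq]

theorem euclNorm_add_le {n : ℕ} (v w : Fin n → ℝ) :
    euclNorm (v + w) ≤ euclNorm v + euclNorm w := by
  simpa only [euclNorm_eq_norm, WithLp.toLp_add] using norm_add_le _ _

theorem euclNorm_sub_le {n : ℕ} (v w : Fin n → ℝ) :
    euclNorm (v - w) ≤ euclNorm v + euclNorm w := by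
  simpa only [euclNorm_eq_norm, WithLp.toLp_sub] using norm_sub_le _ _

theorem euclNorm_neg {n : ℕ} (v : Fin n → ℝ) : euclNorm (-v) = euclNorm v := by
  simp [euclNorm]

theorem euclNorm_smul {n : ℕ} (a : ℝ) (v : Fin n → ℝ) : euclNorm (a • v) = |a| * euclNorm v := by
  simp [euclNorm_eq_norm, norm_smul]

theorem euclNorm_sum_le {n : ℕ} {ι : Type*} (s : Finset ι) (v : ι → Fin n → ℝ) :
    euclNorm (∑ i ∈ s, v i) ≤ ∑ i ∈ s, euclNorm (v i) := by
  simpa only [euclNorm_eq_norm, WithLp.toLp_sum] using norm_sum_le s fun i => WithLp.toLp 2 (v i)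

theorem euclNorm_mulVec_le {m n : ℕ} (M : Matrix (Fin m) (Fin n) ℝ) (v : Fin n → ℝ) :
    euclNorm (M *ᵥ v) ≤ matNorm M * euclNorm v := by
  rw [euclNorm_eq_norm, euclNorm_eq_norm]
  exact (LinearMap.toContinuousLinearMap (Matrix.toEuclideanLin M)).le_opNorm (WithLp.toLp 2 v)

theorem euclNorm_mulVec_of_transpose_mul_self {m n : ℕ} {M : Matrix (Fin m) (Fin n) ℝ}
    (hM : Mᵀ * M = 1) (v : Fin n → ℝ) : euclNorm (M *ᵥ v) = euclNorm v := by
  have key : (M *ᵥ v) ⬝ᵥ (M *ᵥ v) = v ⬝ᵥ v := by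
    rw [dotProduct_mulVec, ← mulVec_transpose, mulVec_mulVec, hM, one_mulVec]
  simp only [dotProduct, ← pow_two] at key
  rw [euclNorm, euclNorm, key]

/-- A vector in the kernel of `C` whose reduced coordinates lie in the row space of `C * Φ` is
controlled by its component orthogonal to the range of `Φ`. -/
theorem euclNorm_le_of_mulVec_eq_zero {N Nb p r : ℕ}
    {Φ : Matrix (Fin N) (Fin p) ℝ} (hΦ : Φᵀ * Φ = 1) {C : Matrix (Fin Nb) (Fin N) ℝ}
    {U : Matrix (Fin Nb) (Fin r) ℝ} {S : Matrix (Fin r) (Fin r) ℝ}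
    {V : Matrix (Fin p) (Fin r) ℝ} (hU : Uᵀ * U = 1) (hV : Vᵀ * V = 1) (hS : IsUnit S.det)
    (hSVD : C * Φ = U * S * Vᵀ) {ρ : Fin N → ℝ} (hC : C *ᵥ ρ = 0) {μ : Fin Nb → ℝ}
    (hμ : Φᵀ *ᵥ ρ = (C * Φ)ᵀ *ᵥ μ) :
    euclNorm ρ ≤ (1 + matNorm (S⁻¹ * Uᵀ * C)) * euclNorm ((1 - Φ * Φᵀ) *ᵥ ρ) := by
  set g := (1 - Φ * Φᵀ) *ᵥ ρ with hg
  set w := Φᵀ *ᵥ ρ with hw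
  have hsplit : ρ = g + Φ *ᵥ w := by
    rw [hg, hw, sub_mulVec, one_mulVec, mulVec_mulVec, sub_add_cancel]
  have hwV : w = V *ᵥ (Vᵀ *ᵥ w) := by
    have hproj : V * Vᵀ * (C * Φ)ᵀ = (C * Φ)ᵀ := by
      rw [hSVD, transpose_mul, transpose_transpose, Matrix.mul_assoc, ← Matrix.mul_assoc Vᵀ V, hV,
        Matrix.one_mul]
    rw [mulVec_mulVec, hμ, mulVec_mulVec, hproj]
  have hCw : (C * Φ) *ᵥ w = -(C *ᵥ g) := by
    rw [hsplit, mulVec_add, mulVec_mulVec w] at hC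
    exact eq_neg_of_add_eq_zero_right hC
  have hinv : S⁻¹ * Uᵀ * (C * Φ) = Vᵀ := by
    rw [hSVD, Matrix.mul_assoc U S, Matrix.mul_assoc S⁻¹, ← Matrix.mul_assoc Uᵀ U, hU,
      Matrix.one_mul, ← Matrix.mul_assoc, nonsing_inv_mul S hS, Matrix.one_mul]
  have hVw : Vᵀ *ᵥ w = -((S⁻¹ * Uᵀ * C) *ᵥ g) := by
    rw [← hinv, ← mulVec_mulVec, hCw, mulVec_neg, mulVec_mulVec]
  have hw_le : euclNorm w ≤ matNorm (S⁻¹ * Uᵀ * C) * euclNorm g := by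
    rw [hwV, euclNorm_mulVec_of_transpose_mul_self hV, hVw, euclNorm_neg]
    exact euclNorm_mulVec_le _ _
  calc euclNorm ρ ≤ euclNorm g + euclNorm (Φ *ᵥ w) := by
        conv_lhs => rw [hsplit]
        exact euclNorm_add_le _ _
    _ ≤ (1 + matNorm (S⁻¹ * Uᵀ * C)) * euclNorm g := by
        rw [euclNorm_mulVec_of_transpose_mul_self hΦ]
        linarith

theorem isUnit_det_of_diagonal_pos {r : ℕ} {S : Matrix (Fin r) (Fin r) ℝ}
    (hdiag : ∀ i j, i ≠ j → S i j = 0) (hpos : ∀ i, 0 < S i i) : IsUnit S.det := by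
  have hS : S = diagonal fun i => S i i := by
    ext i j
    by_cases hij : i = j
    · simp [hij]
    · simp [diagonal, hij, hdiag i j hij]
  rw [hS, det_diagonal]
  exact (Finset.prod_pos fun i _ => hpos i).ne'.isUnit

theorem sum_range_succ_eq_add_sum_Icc {M : Type*} [AddCommMonoid M] (k : ℕ) (a : ℕ → M) :
    ∑ ℓ ∈ Finset.range (k + 1), a ℓ = a 0 + ∑ ℓ ∈ Finset.Icc 1 k, a ℓ := by
  have hr : Finset.range (k + 1) = insert 0 (Finset.Icc 1 k) := by
    ext
    simp
    omega
  rw [hr, Finset.sum_insert (by simp)]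

/-- Local a posteriori state-space error bound for conservative Galerkin
projection. -/
theorem conservative_galerkin_state_error_bound
    (N Nb p k : ℕ) (hN : 0 < N) (hNb : 0 < Nb) (hp : 0 < p) (hk : 1 ≤ k)
    (Φ : Matrix (Fin N) (Fin p) ℝ) (hΦ : Φᵀ * Φ = 1)
    (C : Matrix (Fin Nb) (Fin N) ℝ)
    (Δt : ℝ) (hΔt : 0 < Δt)
    (α β : ℕ → ℝ) (hα0 : α 0 ≠ 0)
    (t : ℕ → ℝ) (x0 : Fin N → ℝ)
    (f : (Fin N → ℝ) → ℝ → (Fin N → ℝ))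
    (κ : ℝ) (hκ : 0 < κ)
    (hLip : ∀ x y s, euclNorm (f x s - f y s) ≤ κ * euclNorm (x - y))
    (h : ℝ) (hdef : h = |α 0| - |β 0| * κ * Δt)
    (hstab : |β 0| * κ * Δt < |α 0|)
    (ε γ : ℕ → ℝ)
    (hε : ∀ ℓ, ε ℓ = |β ℓ| * Δt / h)
    (hγ : ∀ ℓ, γ ℓ = (|α ℓ| + |β ℓ| * κ * Δt) / h)
    (rhat : (ℕ → Fin N → ℝ) → (Fin N → ℝ))
    (hrhat : ∀ y, rhat y = ∑ ℓ ∈ Finset.Icc 1 k,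
      ((β ℓ * Δt) • f (x0 + y ℓ) (t ℓ) - α ℓ • y ℓ))
    (x : ℕ → Fin N → ℝ)
    (hFOM : α 0 • x 0 = (β 0 * Δt) • f (x0 + x 0) (t 0) + rhat x)
    (xh : ℕ → Fin p → ℝ) (lam : ℕ → Fin Nb → ℝ)
    (hROM : α 0 • xh 0 = (β 0 * Δt) • Φᵀ.mulVec (f (x0 + Φ.mulVec (xh 0)) (t 0))
      + Φᵀ.mulVec (rhat (fun ℓ => Φ.mulVec (xh ℓ)))
      - ∑ j ∈ Finset.range (k + 1), α j • (Φᵀ * Cᵀ).mulVec (lam j))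
    (hcons : α 0 • (C * Φ).mulVec (xh 0)
      = (β 0 * Δt) • C.mulVec (f (x0 + Φ.mulVec (xh 0)) (t 0))
        + C.mulVec (rhat (fun ℓ => Φ.mulVec (xh ℓ))))
    (r : ℕ) (hr : r = (C * Φ).rank)
    (U : Matrix (Fin Nb) (Fin r) ℝ) (Sg : Matrix (Fin r) (Fin r) ℝ)
    (V : Matrix (Fin p) (Fin r) ℝ)
    (hU : Uᵀ * U = 1) (hV : Vᵀ * V = 1)
    (hSdiag : ∀ i j : Fin r, i ≠ j → Sg i j = 0)
    (hSpos : ∀ i : Fin r, 0 < Sg i i)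
    (hSVD : C * Φ = U * Sg * Vᵀ)
    (Vb : Matrix (Fin N) (Fin r) ℝ) (hVb : Vb = Φ * V)
    (Z : Matrix (Fin N) (Fin (N - r)) ℝ)
    (hZ : Zᵀ * Z = 1) (hZV : Zᵀ * Vb = 0)
    (hdecomp : Vb * Vbᵀ + Z * Zᵀ = 1)
    (e : ℕ → Fin N → ℝ) (he : ∀ m, e m = x m - Φ.mulVec (xh m))
    (ζ : ℝ) (hζ : ζ = matNorm (Sg⁻¹ * Uᵀ * C)) :
    euclNorm (e 0) ≤
      (1 + ζ) * (∑ ℓ ∈ Finset.range (k + 1),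
        ε ℓ * euclNorm ((1 - Φ * Φᵀ).mulVec (f (x0 + Φ.mulVec (xh ℓ)) (t ℓ))))
      + ∑ ℓ ∈ Finset.Icc 1 k, γ ℓ * euclNorm (e ℓ) := by
  have hpos : 0 < h := by rw [hdef]; linarith
  set q : ℕ → Fin N → ℝ := fun ℓ => Φ *ᵥ xh ℓ with hq
  set F : ℕ → Fin N → ℝ := fun ℓ => f (x0 + Φ *ᵥ xh ℓ) (t ℓ) with hF
  set ρ : Fin N → ℝ := α 0 • q 0 - (β 0 * Δt) • F 0 - rhat q with hρ
  have hCρ : C *ᵥ ρ = 0 := by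
    have hcons' : α 0 • (C *ᵥ q 0) = (β 0 * Δt) • C *ᵥ F 0 + C *ᵥ rhat q := by
      rw [hq, mulVec_mulVec]; exact hcons
    rw [hρ, mulVec_sub, mulVec_sub, mulVec_smul, mulVec_smul, hcons']
    abel
  have hΦρ : Φᵀ *ᵥ ρ = (C * Φ)ᵀ *ᵥ (-∑ j ∈ Finset.range (k + 1), α j • lam j) := by
    have hROM' : α 0 • xh 0 = (β 0 * Δt) • Φᵀ *ᵥ F 0 + Φᵀ *ᵥ rhat q
        - ∑ j ∈ Finset.range (k + 1), α j • (Φᵀ * Cᵀ) *ᵥ lam j := hROM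
    have hq0 : Φᵀ *ᵥ q 0 = xh 0 := by rw [hq, mulVec_mulVec, hΦ, one_mulVec]
    rw [hρ, mulVec_sub, mulVec_sub, mulVec_smul, mulVec_smul, hq0, hROM', mulVec_neg,
      mulVec_sum, transpose_mul]
    simp only [mulVec_smul]
    abel
  have hres := euclNorm_le_of_mulVec_eq_zero hΦ hU hV
    (isUnit_det_of_diagonal_pos hSdiag hSpos) hSVD hCρ hΦρ
  rw [← hζ] at hres
  have hζ0 : 0 ≤ ζ := hζ ▸ norm_nonneg _
  have hρsum : ρ = ∑ ℓ ∈ Finset.range (k + 1), (α ℓ • q ℓ - (β ℓ * Δt) • F ℓ) := by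
    rw [hρ, hrhat, sum_range_succ_eq_add_sum_Icc, sub_eq_add_neg, ← Finset.sum_neg_distrib]
    simp only [neg_sub, hq, hF]
  have hproj : (1 - Φ * Φᵀ) *ᵥ ρ
      = ∑ ℓ ∈ Finset.range (k + 1), (-(β ℓ * Δt)) • ((1 - Φ * Φᵀ) *ᵥ F ℓ) := by
    have hann : ∀ ℓ, (1 - Φ * Φᵀ) *ᵥ q ℓ = 0 := fun ℓ => by
      rw [hq, mulVec_mulVec, Matrix.sub_mul, Matrix.mul_assoc, hΦ, Matrix.one_mul, Matrix.mul_one,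
        sub_self, zero_mulVec]
    rw [hρsum, mulVec_sum]
    refine Finset.sum_congr rfl fun ℓ _ => ?_
    rw [mulVec_sub, mulVec_smul, mulVec_smul, hann, smul_zero, zero_sub, neg_smul]
  have hproj_le : euclNorm ((1 - Φ * Φᵀ) *ᵥ ρ)
      ≤ ∑ ℓ ∈ Finset.range (k + 1), |β ℓ| * Δt * euclNorm ((1 - Φ * Φᵀ) *ᵥ F ℓ) := by
    rw [hproj]
    refine (euclNorm_sum_le _ _).trans_eq (Finset.sum_congr rfl fun ℓ _ => ?_)
    rw [euclNorm_smul, abs_neg, abs_mul, abs_of_pos hΔt]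
  have hf_le : ∀ ℓ, euclNorm ((β ℓ * Δt) • (f (x0 + x ℓ) (t ℓ) - F ℓ))
      ≤ |β ℓ| * κ * Δt * euclNorm (e ℓ) := fun ℓ => by
    have hL := hLip (x0 + x ℓ) (x0 + q ℓ) (t ℓ)
    rw [add_sub_add_left_eq_sub, hq, ← he] at hL
    rw [euclNorm_smul, abs_mul, abs_of_pos hΔt]
    calc |β ℓ| * Δt * euclNorm (f (x0 + x ℓ) (t ℓ) - F ℓ)
        ≤ |β ℓ| * Δt * (κ * euclNorm (e ℓ)) := by gcongr
      _ = |β ℓ| * κ * Δt * euclNorm (e ℓ) := by ring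
  have herr : α 0 • e 0 = (β 0 * Δt) • (f (x0 + x 0) (t 0) - F 0)
      + ∑ ℓ ∈ Finset.Icc 1 k, ((β ℓ * Δt) • (f (x0 + x ℓ) (t ℓ) - F ℓ) - α ℓ • e ℓ) - ρ := by
    have hdiff : ∑ ℓ ∈ Finset.Icc 1 k, ((β ℓ * Δt) • (f (x0 + x ℓ) (t ℓ) - F ℓ) - α ℓ • e ℓ)
        = rhat x - rhat q := by
      rw [hrhat, hrhat, ← Finset.sum_sub_distrib]
      refine Finset.sum_congr rfl fun ℓ _ => ?_
      rw [he, smul_sub, smul_sub]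
      simp only [hF, hq]
      abel
    rw [hdiff, he, smul_sub, hFOM, hρ, smul_sub]
    abel
  have hstep : |α 0| * euclNorm (e 0) ≤ |β 0| * κ * Δt * euclNorm (e 0)
      + ∑ ℓ ∈ Finset.Icc 1 k, (|α ℓ| + |β ℓ| * κ * Δt) * euclNorm (e ℓ) + euclNorm ρ := by
    rw [← euclNorm_smul, herr]
    refine (euclNorm_sub_le _ _).trans (add_le_add_left ((euclNorm_add_le _ _).trans
      (add_le_add (hf_le 0) ((euclNorm_sum_le _ _).trans
        (Finset.sum_le_sum fun ℓ _ => (euclNorm_sub_le _ _).trans ?_)))) _)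
    rw [euclNorm_smul (α ℓ)]
    linarith [hf_le ℓ]
  have hmain : h * euclNorm (e 0)
      ≤ (1 + ζ) * ∑ ℓ ∈ Finset.range (k + 1), |β ℓ| * Δt * euclNorm ((1 - Φ * Φᵀ) *ᵥ F ℓ)
        + ∑ ℓ ∈ Finset.Icc 1 k, (|α ℓ| + |β ℓ| * κ * Δt) * euclNorm (e ℓ) := by
    have hscale := mul_le_mul_of_nonneg_left hproj_le (by linarith : 0 ≤ 1 + ζ)
    rw [hdef, sub_mul]
    linarith
  have hεsum : ∑ ℓ ∈ Finset.range (k + 1), ε ℓ * euclNorm ((1 - Φ * Φᵀ) *ᵥ F ℓ)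
      = (∑ ℓ ∈ Finset.range (k + 1), |β ℓ| * Δt * euclNorm ((1 - Φ * Φᵀ) *ᵥ F ℓ)) / h := by
    rw [Finset.sum_div]
    exact Finset.sum_congr rfl fun ℓ _ => by rw [hε, div_mul_eq_mul_div]
  have hγsum : ∑ ℓ ∈ Finset.Icc 1 k, γ ℓ * euclNorm (e ℓ)
      = (∑ ℓ ∈ Finset.Icc 1 k, (|α ℓ| + |β ℓ| * κ * Δt) * euclNorm (e ℓ)) / h := by
    rw [Finset.sum_div]
    exact Finset.sum_congr rfl fun ℓ _ => by rw [hγ, div_mul_eq_mul_div]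
  change euclNorm (e 0) ≤ (1 + ζ) * (∑ ℓ ∈ Finset.range (k + 1),
    ε ℓ * euclNorm ((1 - Φ * Φᵀ) *ᵥ F ℓ)) + ∑ ℓ ∈ Finset.Icc 1 k, γ ℓ * euclNorm (e ℓ)
  rw [hεsum, hγsum, ← mul_div_assoc, ← add_div, le_div_iff₀ hpos, mul_comm (euclNorm (e 0))]
  exact hmain
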